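/- Let 2 ≤ k ≤ n. For every δ ∈ (0,1) there exists ε > 0, depending only on n, k and δ, with the following property: if λ lies in the closure of the Gårding cone Γ_k, its entries are ordered λ₁ ≥ λ₂ ≥ ⋯ ≥ λ_n with λ₁ > 0, and either σ_k(λ) ≤ ε·λ₁^k, or |λ_i| ≤ ε·λ₁ for every i = k+1, k+2, …, n, then λ₁ · σ_{k-1;1}(λ) ≥ (1 − δ) · σ_k(λ). -/

import Mathlib

/-- The `m`-th elementary symmetric polynomial of `λ ∈ ℝⁿ`. -/
noncomputable def esymm (n m : ℕ) (lam : Fin n → ℝ) : ℝ :=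
  ∑ s ∈ Finset.powersetCard m (Finset.univ : Finset (Fin n)), ∏ i ∈ s, lam i

/-- The Gårding cone `Γ_k`. -/
def GardingCone (n k : ℕ) : Set (Fin n → ℝ) :=
  {lam | ∀ j, 1 ≤ j → j ≤ k → 0 < esymm n j lam}

/-- `σ_{m;i}(λ)`: the `m`-th elementary symmetric polynomial of `λ` with the entry
`λ_i` replaced by `0`. -/
noncomputable def esymmDel (n m : ℕ) (i : Fin n) (lam : Fin n → ℝ) : ℝ :=
  esymm n m (Function.update lam i 0)

open Polynomial in
/-- Laguerre's inequality at the origin for a real-rooted polynomial. -/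
theorem Polynomial.Splits.two_mul_coeff_mul_coeff_le {p : ℝ[X]} (hp : p.Splits) :
    2 * p.coeff 0 * p.coeff 2 ≤ p.coeff 1 ^ 2 := by
  induction hp using Submonoid.closure_induction with
  | mem x hx =>
    rcases hx with ⟨a, rfl⟩ | ⟨a, rfl⟩ <;> simp [coeff_X, coeff_C]
  | one => simp [coeff_one]
  | mul f g _ _ hf hg =>
    have h2 : (f * g).coeff 2 =
        f.coeff 0 * g.coeff 2 + f.coeff 1 * g.coeff 1 + f.coeff 2 * g.coeff 0 := by
      rw [coeff_mul, Finset.Nat.sum_antidiagonal_eq_sum_range_succ_mk]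
      simp [Finset.sum_range_succ]
    rw [mul_coeff_zero, mul_coeff_one, h2]
    nlinarith [mul_le_mul_of_nonneg_left hf (sq_nonneg (g.coeff 0)),
      mul_le_mul_of_nonneg_left hg (sq_nonneg (f.coeff 0))]

open Polynomial in
theorem Polynomial.Splits.derivative_real {p : ℝ[X]} (hp : p.Splits) :
    (derivative p).Splits := by
  rw [splits_iff_card_roots] at hp ⊢
  have h1 := card_roots_le_derivative p
  have h2 := card_roots' (derivative p)
  have h3 := natDegree_derivative_le p
  rcases Nat.eq_zero_or_pos p.natDegree with h0 | h0
  · rw [natDegree_eq_zero] at h0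
    obtain ⟨c, rfl⟩ := h0
    simp
  · omega

open Polynomial in
theorem Polynomial.Splits.coeff_mul_coeff_le_sq {p : ℝ[X]} (hp : p.Splits) (m : ℕ) :
    p.coeff m * p.coeff (m + 2) ≤ p.coeff (m + 1) ^ 2 := by
  have hs : (derivative^[m] p).Splits := by
    induction m with
    | zero => simpa
    | succ m ih => rw [Function.iterate_succ_apply']; exact ih.derivative_real
  have h := hs.two_mul_coeff_mul_coeff_le
  simp only [coeff_iterate_derivative, nsmul_eq_mul] at h
  have e0 : ((0 + m).descFactorial m : ℝ) = m.factorial := by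
    simp [Nat.descFactorial_self]
  have e1 : ((1 + m).descFactorial m : ℝ) = (m + 1) * m.factorial := by
    have := Nat.factorial_mul_descFactorial (show m ≤ 1 + m by omega)
    rw [Nat.add_sub_cancel, Nat.factorial_one, one_mul] at this
    rw [this, add_comm, Nat.factorial_succ]; push_cast; ring
  have e2 : 2 * ((2 + m).descFactorial m : ℝ) = (m + 2) * (m + 1) * m.factorial := by
    have := Nat.factorial_mul_descFactorial (show m ≤ 2 + m by omega)
    rw [Nat.add_sub_cancel, Nat.factorial_two] at this
    have h' : (2 : ℝ) * ((2 + m).descFactorial m : ℝ) = ((2 + m).factorial : ℕ) := by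
      exact_mod_cast this
    rw [h', add_comm, Nat.factorial_succ, Nat.factorial_succ]; push_cast; ring
  rw [e0, e1, zero_add, add_comm 1 m, add_comm 2 m] at h
  rw [add_comm 2 m] at e2
  have hf : (0 : ℝ) < m.factorial := by positivity
  have h' : ((m : ℝ) + 2) * (p.coeff m * p.coeff (m + 2)) ≤ (m + 1) * p.coeff (m + 1) ^ 2 := by
    have h3 : (((m : ℝ) + 1) * m.factorial ^ 2) * (((m : ℝ) + 2) * (p.coeff m * p.coeff (m + 2)))
        ≤ (((m : ℝ) + 1) * m.factorial ^ 2) * ((m + 1) * p.coeff (m + 1) ^ 2) := by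
      calc _ = (m.factorial * p.coeff m * p.coeff (m + 2)) *
            ((m + 2) * (m + 1) * m.factorial) := by ring
        _ ≤ _ := by rw [← e2]; linarith
    exact le_of_mul_le_mul_left h3 (by positivity)
  by_contra! hlt
  have hm : (0 : ℝ) ≤ m := m.cast_nonneg
  nlinarith [sq_nonneg (p.coeff (m + 1))]

namespace Multiset

theorem esymm_zero_right {R : Type*} [CommSemiring R] (s : Multiset R) : s.esymm 0 = 1 := by
  simp [esymm]

theorem esymm_one_right {R : Type*} [CommSemiring R] (s : Multiset R) : s.esymm 1 = s.sum := by
  simp [esymm, powersetCard_one]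

theorem esymm_cons_succ {R : Type*} [CommSemiring R] (a : R) (s : Multiset R) (m : ℕ) :
    (a ::ₘ s).esymm (m + 1) = a * s.esymm m + s.esymm (m + 1) := by
  simp [esymm, powersetCard_cons, sum_map_mul_left, add_comm]

theorem esymm_zero_cons {R : Type*} [CommSemiring R] (s : Multiset R) (m : ℕ) :
    ((0 : R) ::ₘ s).esymm m = s.esymm m := by
  cases m with
  | zero => simp [esymm_zero_right]
  | succ m => simp [esymm_cons_succ]

open Polynomial in
/-- A weak form of Newton's inequality: the elementary symmetric polynomials of real numbers form
a log-concave sequence. -/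
theorem esymm_mul_esymm_le_sq (s : Multiset ℝ) (m : ℕ) :
    s.esymm m * s.esymm (m + 2) ≤ s.esymm (m + 1) ^ 2 := by
  rcases lt_or_ge (card s) (m + 2) with h | h
  · have : s.esymm (m + 2) = 0 := by simp [esymm, powersetCard_eq_empty _ h]
    rw [this, mul_zero]; positivity
  · have hp : (s.map fun r => X + C r).prod.Splits :=
      Splits.multisetProd fun f hf => by
        obtain ⟨r, -, rfl⟩ := mem_map.1 hf
        exact Splits.X_add_C r
    have := hp.coeff_mul_coeff_le_sq (card s - (m + 2))
    rw [prod_X_add_C_coeff _ (by omega), prod_X_add_C_coeff _ (by omega),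
      prod_X_add_C_coeff _ (by omega), show card s - (card s - (m + 2)) = m + 2 by omega,
      show card s - (card s - (m + 2) + 2) = m by omega,
      show card s - (card s - (m + 2) + 1) = m + 1 by omega] at this
    linarith

/-- Deleting an entry maps the Gårding cone `Γ_{k+1}` into `Γ_k`. -/
theorem esymm_pos_of_cons {a : ℝ} {s : Multiset ℝ} {k : ℕ}
    (h : ∀ j ≤ k + 1, 0 < (a ::ₘ s).esymm j) : ∀ j ≤ k, 0 < s.esymm j := by
  intro j
  induction j with
  | zero => intro _; simp [esymm_zero_right]
  | succ j ih =>
    intro hj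
    have hpos := ih (by omega)
    have h1 := h (j + 1) (by omega)
    have h2 := h (j + 2) (by omega)
    rw [esymm_cons_succ] at h1 h2
    have hN := s.esymm_mul_esymm_le_sq j
    by_contra! hle
    have h3 := mul_pos hpos h2
    nlinarith [mul_nonneg (neg_nonneg.2 hle) h1.le]

/-- If at most `k` entries exceed `M`, then the quotient `σ_{k+1} / σ_k` is at most a multiple
of `M` on `Γ_k`. -/
theorem esymm_succ_le_mul_esymm {M : ℝ} (hM : 0 ≤ M) (k : ℕ) (s : Multiset ℝ)
    (h : ∀ j ≤ k, 0 < s.esymm j) (hs : card (s.filter (M < ·)) ≤ k) :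
    s.esymm (k + 1) ≤ card s * M * s.esymm k := by
  induction k generalizing s with
  | zero =>
    rw [zero_add, esymm_one_right, esymm_zero_right, mul_one, ← nsmul_eq_mul]
    refine sum_le_card_nsmul _ _ fun x hx => ?_
    by_contra! hlt
    have : x ∈ s.filter (M < ·) := mem_filter.2 ⟨hx, hlt⟩
    rw [card_eq_zero.1 (Nat.le_zero.1 hs)] at this
    simp at this
  | succ k ih =>
    obtain ⟨a, t, rfl, ha, ht⟩ : ∃ a t, s = a ::ₘ t ∧ 0 < a ∧ card (t.filter (M < ·)) ≤ k := by
      by_cases hex : ∃ a ∈ s, M < a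
      · obtain ⟨a, has, ha⟩ := hex
        obtain ⟨t, rfl⟩ := exists_cons_of_mem has
        refine ⟨a, t, rfl, hM.trans_lt ha, ?_⟩
        rw [filter_cons_of_pos _ ha, card_cons] at hs
        exact Nat.le_of_succ_le_succ hs
      · push Not at hex
        have h1 := h 1 (by omega)
        rw [esymm_one_right] at h1
        obtain ⟨a, has, ha⟩ : ∃ a ∈ s, 0 < a := by
          by_contra! hle
          have := sum_le_card_nsmul s 0 hle
          simp at this
          linarith
        obtain ⟨t, rfl⟩ := exists_cons_of_mem has
        refine ⟨a, t, rfl, ha, ?_⟩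
        rw [filter_eq_nil.2 fun x hx => not_lt.2 (hex x (mem_cons_of_mem hx))]
        simp
    have htpos := esymm_pos_of_cons h
    have hI := ih t htpos ht
    have hN := t.esymm_mul_esymm_le_sq k
    have h0 := htpos k le_rfl
    have hs1 := h (k + 1) le_rfl
    set c : ℝ := card t * M with hc
    have hc0 : 0 ≤ c := by positivity
    have hcons : (a ::ₘ t).esymm (k + 1) = a * t.esymm k + t.esymm (k + 1) := esymm_cons_succ ..
    calc (a ::ₘ t).esymm (k + 1 + 1) = a * t.esymm (k + 1) + t.esymm (k + 2) := esymm_cons_succ ..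
      _ ≤ c * (a ::ₘ t).esymm (k + 1) := by
        by_cases h1 : 0 ≤ t.esymm (k + 1)
        · have hnext : t.esymm (k + 2) ≤ c * t.esymm (k + 1) := by
            refine le_of_mul_le_mul_left ?_ h0
            nlinarith [mul_le_mul_of_nonneg_left hI h1]
          rw [hcons]
          nlinarith [mul_le_mul_of_nonneg_left hI ha.le]
        · refine le_trans ?_ (mul_nonneg hc0 hs1.le)
          refine le_of_mul_le_mul_left ?_ h0
          rw [hcons] at hs1
          nlinarith [mul_pos (neg_pos.2 (not_le.1 h1)) hs1]
      _ ≤ _ := by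
        refine mul_le_mul_of_nonneg_right ?_ hs1.le
        rw [card_cons, hc]; push_cast; nlinarith

/-- A weak form of Maclaurin's inequality on the Gårding cone. -/
theorem esymm_succ_pow_le (s : Multiset ℝ) (k : ℕ) (h : ∀ j ≤ k, 0 < s.esymm j)
    (hk : 0 ≤ s.esymm (k + 1)) : s.esymm (k + 1) ^ k ≤ s.esymm k ^ (k + 1) := by
  induction k with
  | zero => simp [esymm_zero_right]
  | succ k ih =>
    have hy := h (k + 1) le_rfl
    have hz := h k (by omega)
    have hI := ih (fun j hj => h j (by omega)) hy.le
    have hN := s.esymm_mul_esymm_le_sq k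
    refine le_of_mul_le_mul_left ?_ (pow_pos hz (k + 1))
    calc s.esymm k ^ (k + 1) * s.esymm (k + 1 + 1) ^ (k + 1)
        = (s.esymm k * s.esymm (k + 2)) ^ (k + 1) := (mul_pow ..).symm
      _ ≤ (s.esymm (k + 1) ^ 2) ^ (k + 1) := pow_le_pow_left₀ (mul_nonneg hz.le hk) hN _
      _ = s.esymm (k + 1) ^ k * s.esymm (k + 1) ^ (k + 1 + 1) := by ring
      _ ≤ _ := mul_le_mul_of_nonneg_right hI (by positivity)

end Multiset

/-- The entries of `lam` other than the one at `i`. -/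
def otherEntries {n : ℕ} (i : Fin n) (lam : Fin n → ℝ) : Multiset ℝ :=
  (Finset.univ.erase i).val.map lam

theorem card_otherEntries_le {n : ℕ} (i : Fin n) (lam : Fin n → ℝ) :
    Multiset.card (otherEntries i lam) ≤ n := by
  simp [otherEntries]

theorem esymm_eq_esymm_cons {n : ℕ} (m : ℕ) (i : Fin n) (lam : Fin n → ℝ) :
    esymm n m lam = (lam i ::ₘ otherEntries i lam).esymm m := by
  have : lam i ::ₘ otherEntries i lam = Finset.univ.val.map lam := by
    rw [otherEntries, ← Multiset.map_cons, ← Finset.insert_val_of_notMem (by simp),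
      Finset.insert_erase (Finset.mem_univ i)]
  rw [this, Finset.esymm_map_val, esymm]

theorem esymmDel_eq_esymm {n : ℕ} (m : ℕ) (i : Fin n) (lam : Fin n → ℝ) :
    esymmDel n m i lam = (otherEntries i lam).esymm m := by
  have : otherEntries i (Function.update lam i 0) = otherEntries i lam :=
    Multiset.map_congr rfl fun j hj =>
      Function.update_of_ne (Finset.ne_of_mem_erase (Finset.mem_def.2 hj)) _ _
  rw [esymmDel, esymm_eq_esymm_cons m i, this, Function.update_self, Multiset.esymm_zero_cons]

theorem esymm_succ_eq_mul_esymmDel_add {n : ℕ} (m : ℕ) (i : Fin n) (lam : Fin n → ℝ) :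
    esymm n (m + 1) lam = lam i * esymmDel n m i lam + esymmDel n (m + 1) i lam := by
  rw [esymm_eq_esymm_cons _ i, Multiset.esymm_cons_succ, esymmDel_eq_esymm, esymmDel_eq_esymm]

theorem continuous_esymm (n m : ℕ) : Continuous (esymm n m) := by
  unfold esymm; fun_prop

theorem continuous_esymmDel (n m : ℕ) (i : Fin n) : Continuous (esymmDel n m i) :=
  (continuous_esymm n m).comp (by fun_prop)

theorem esymm_otherEntries_pos {n k : ℕ} (i : Fin n) {lam : Fin n → ℝ}
    (h : lam ∈ GardingCone n (k + 1)) : ∀ j ≤ k, 0 < (otherEntries i lam).esymm j := by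
  refine Multiset.esymm_pos_of_cons (a := lam i) fun j hj => ?_
  rcases Nat.eq_zero_or_pos j with rfl | hj0
  · simp [Multiset.esymm_zero_right]
  · rw [← esymm_eq_esymm_cons]
    exact h j hj0 hj

theorem esymm_nonneg_of_mem_closure {n k : ℕ} (hk : 1 ≤ k) {lam : Fin n → ℝ}
    (h : lam ∈ closure (GardingCone n k)) : 0 ≤ esymm n k lam :=
  le_on_closure (f := fun _ => 0) (fun _ hx => (hx k hk le_rfl).le) continuousOn_const
    (continuous_esymm n k).continuousOn h

theorem esymmDel_nonneg_of_mem_closure {n k : ℕ} (i : Fin n) {lam : Fin n → ℝ}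
    (h : lam ∈ closure (GardingCone n (k + 1))) : 0 ≤ esymmDel n k i lam :=
  le_on_closure (f := fun _ => 0)
    (fun _ hx => by rw [esymmDel_eq_esymm]; exact (esymm_otherEntries_pos i hx k le_rfl).le)
    continuousOn_const (continuous_esymmDel n k i).continuousOn h

theorem max_esymmDel_succ_pow_le {n k : ℕ} (i : Fin n) {lam : Fin n → ℝ}
    (h : lam ∈ closure (GardingCone n (k + 1))) :
    max (esymmDel n (k + 1) i lam) 0 ^ k ≤ esymmDel n k i lam ^ (k + 1) := by
  refine le_on_closure (f := fun x => max (esymmDel n (k + 1) i x) 0 ^ k)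
    (g := fun x => esymmDel n k i x ^ (k + 1)) (fun x hx => ?_)
    (((continuous_esymmDel n (k + 1) i).max continuous_const).pow k).continuousOn
    ((continuous_esymmDel n k i).pow (k + 1)).continuousOn h
  have hpos := esymm_otherEntries_pos i hx
  simp only [esymmDel_eq_esymm]
  rcases le_total 0 ((otherEntries i x).esymm (k + 1)) with h0 | h0
  · rw [max_eq_left h0]
    exact Multiset.esymm_succ_pow_le _ k hpos h0
  · rw [max_eq_right h0]
    rcases Nat.eq_zero_or_pos k with rfl | hk
    · simp [Multiset.esymm_zero_right]
    · rw [zero_pow hk.ne']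
      exact pow_nonneg (hpos k le_rfl).le _

theorem esymmDel_succ_le_sum_abs_mul {n k : ℕ} (hn : 0 < n) {lam : Fin n → ℝ}
    (h : lam ∈ closure (GardingCone n (k + 1))) :
    esymmDel n (k + 1) ⟨0, hn⟩ lam ≤
      n * (∑ i with k + 1 ≤ i.val, |lam i|) * esymmDel n k ⟨0, hn⟩ lam := by
  refine le_on_closure (f := fun x => esymmDel n (k + 1) ⟨0, hn⟩ x)
    (g := fun x => n * (∑ i with k + 1 ≤ i.val, |x i|) * esymmDel n k ⟨0, hn⟩ x)
    (fun x hx => ?_) (continuous_esymmDel n (k + 1) _).continuousOn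
    (Continuous.continuousOn (.mul (by fun_prop) (continuous_esymmDel n k _))) h
  have hpos := esymm_otherEntries_pos ⟨0, hn⟩ hx
  simp only [esymmDel_eq_esymm]
  set M := ∑ i with k + 1 ≤ i.val, |x i|
  have hM : 0 ≤ M := Finset.sum_nonneg fun _ _ => abs_nonneg _
  have hcard : Multiset.card ((otherEntries ⟨0, hn⟩ x).filter (M < ·)) ≤ k := by
    rw [otherEntries, Multiset.filter_map, Multiset.card_map]
    change ((Finset.univ.erase ⟨0, hn⟩).filter fun i => M < x i).card ≤ k
    have : k = (Finset.Ico 1 (k + 1)).card := by simp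
    rw [this]
    refine Finset.card_le_card_of_injOn Fin.val (fun i hi => ?_) Fin.val_injective.injOn
    simp only [Finset.coe_filter, Finset.mem_erase, Finset.mem_univ, and_true, ne_eq,
      Set.mem_ofPred_eq, Fin.ext_iff] at hi
    simp only [Finset.coe_Ico, Set.mem_Ico]
    refine ⟨by omega, ?_⟩
    by_contra! hki
    have := Finset.single_le_sum (f := fun i => |x i|) (fun _ _ => abs_nonneg _)
      (s := Finset.univ.filter fun i : Fin n => k + 1 ≤ i.val)
      (Finset.mem_filter.2 ⟨Finset.mem_univ i, hki⟩)
    exact absurd ((le_abs_self _).trans this) (not_le.2 hi.2)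
  refine (Multiset.esymm_succ_le_mul_esymm hM k _ hpos hcard).trans ?_
  have := (hpos k le_rfl).le
  have hc : (Multiset.card (otherEntries ⟨0, hn⟩ x) : ℝ) ≤ n :=
    Nat.cast_le.2 (card_otherEntries_le _ _)
  gcongr

/-- for `2 ≤ k ≤ n` and `δ ∈ (0,1)` there exists `ε > 0` (depending only on
`n, k, δ`) such that for every `λ` in the closure of `Γ_k` with entries ordered
`λ₁ ≥ ⋯ ≥ λ_n` and `λ₁ > 0`, if `σ_k(λ) ≤ ε λ₁^k` or `|λ_i| ≤ ε λ₁` for all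
`i = k+1, …, n` (i.e. all `Fin`-indices `i` with `k ≤ i`), then
`λ₁ σ_{k-1;1}(λ) ≥ (1-δ) σ_k(λ)`. -/
theorem stmt6 (n k : ℕ) (hk : 2 ≤ k) (hkn : k ≤ n) (δ : ℝ) (hδ0 : 0 < δ) (hδ1 : δ < 1) :
    ∃ ε : ℝ, 0 < ε ∧ ∀ lam ∈ closure (GardingCone n k), Antitone lam →
      0 < lam ⟨0, by omega⟩ →
      (esymm n k lam ≤ ε * (lam ⟨0, by omega⟩) ^ k ∨
        ∀ i : Fin n, k ≤ (i : ℕ) → |lam i| ≤ ε * lam ⟨0, by omega⟩) →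
      lam ⟨0, by omega⟩ * esymmDel n (k - 1) ⟨0, by omega⟩ lam ≥ (1 - δ) * esymm n k lam := by
  obtain ⟨k, rfl⟩ : ∃ m, k = m + 1 := ⟨k - 1, by omega⟩
  have hn : 0 < n := by omega
  have hn' : (0 : ℝ) < n := Nat.cast_pos.2 hn
  have hk0 : k ≠ 0 := by omega
  refine ⟨min (δ ^ k) (δ / n ^ 2), lt_min (by positivity) (by positivity), ?_⟩
  intro lam hlam _ ha hor
  set ε := min (δ ^ k) (δ / n ^ 2)
  have hσ := esymm_nonneg_of_mem_closure (by omega) hlam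
  have hs := esymmDel_nonneg_of_mem_closure ⟨0, hn⟩ hlam
  have hsum := esymm_succ_eq_mul_esymmDel_add k ⟨0, hn⟩ lam
  rw [Nat.add_sub_cancel]
  have key : esymmDel n (k + 1) ⟨0, hn⟩ lam ≤ δ * (lam ⟨0, hn⟩ * esymmDel n k ⟨0, hn⟩ lam) := by
    have hrhs : 0 ≤ δ * (lam ⟨0, hn⟩ * esymmDel n k ⟨0, hn⟩ lam) := by positivity
    rcases le_total (esymmDel n (k + 1) ⟨0, hn⟩ lam) 0 with ht | ht
    · exact ht.trans hrhs
    rcases hor with h | h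
    · have hmac := max_esymmDel_succ_pow_le ⟨0, hn⟩ hlam
      rw [max_eq_left ht] at hmac
      have hsε : esymmDel n k ⟨0, hn⟩ lam ≤ δ ^ k * lam ⟨0, hn⟩ ^ k := by
        refine le_of_mul_le_mul_left ?_ ha
        calc lam ⟨0, hn⟩ * esymmDel n k ⟨0, hn⟩ lam ≤ esymm n (k + 1) lam := by linarith
          _ ≤ ε * lam ⟨0, hn⟩ ^ (k + 1) := h
          _ ≤ δ ^ k * lam ⟨0, hn⟩ ^ (k + 1) := by gcongr; exact min_le_left _ _
          _ = _ := by ring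
      refine le_of_pow_le_pow_left₀ hk0 hrhs (hmac.trans ?_)
      calc esymmDel n k ⟨0, hn⟩ lam ^ (k + 1)
          = esymmDel n k ⟨0, hn⟩ lam ^ k * esymmDel n k ⟨0, hn⟩ lam := pow_succ ..
        _ ≤ esymmDel n k ⟨0, hn⟩ lam ^ k * (δ ^ k * lam ⟨0, hn⟩ ^ k) := by gcongr
        _ = _ := by ring
    · refine (esymmDel_succ_le_sum_abs_mul hn hlam).trans ?_
      have hM : ∑ i : Fin n with k + 1 ≤ i.val, |lam i| ≤ n * (ε * lam ⟨0, hn⟩) := by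
        refine (Finset.sum_le_card_nsmul _ _ _ fun i hi => h i (Finset.mem_filter.1 hi).2).trans ?_
        rw [nsmul_eq_mul]
        have hε : 0 ≤ ε := le_min (by positivity) (by positivity)
        gcongr
        exact (Finset.card_le_univ _).trans_eq (Fintype.card_fin n)
      have hε : (n : ℝ) ^ 2 * ε ≤ δ := by
        rw [mul_comm, ← le_div_iff₀ (by positivity)]
        exact min_le_right _ _
      calc _ ≤ n * (n * (ε * lam ⟨0, hn⟩)) * esymmDel n k ⟨0, hn⟩ lam := by gcongr
        _ = n ^ 2 * ε * (lam ⟨0, hn⟩ * esymmDel n k ⟨0, hn⟩ lam) := by ring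
        _ ≤ _ := by gcongr
  rw [hsum, ge_iff_le]
  rw [hsum] at hσ
  nlinarith [mul_nonneg hδ0.le hσ]
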